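/- arXiv:1703.03163 — 3 statements merged into one kernel-verified Lean document; each statement's English description precedes it below -/
import Mathlib

section
/- Let p ∈ Ω and ρ₀ > 0. Let ν₀ be a positive integer with 2^{−ν₀} ≤ ρ₀/3 and let δ₀ > 0 be such that |κ(ω′) − κ(p)| ≤ ρ₀/18 whenever d_Ω(ω′, p) ≤ δ₀. If an integer j is in a ν₀-trapped period of ω for U_{δ₀}(p), then d_M(f_ω^{(j)}(x), X_p) ≤ (2/3)ρ₀ for every x ∈ I₀. -/
open MeasureTheory Filter Metric Set Topology

noncomputable section

/-- The circle `M = ℝ/ℤ`. -/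
abbrev Circle1 : Type := AddCircle (1 : ℝ)

/-- `I₀ = π_M([1/4, 3/4])`. -/
def I0 : Set Circle1 := (fun x : ℝ => (x : Circle1)) '' Set.Icc (1/4 : ℝ) (3/4)

/-- The iterates of the nonautonomous dynamical system induced by `f` over `θ`. -/
def ndsIter {Ω : Type*} (θ : Ω → Ω) (f : Ω → Circle1 → Circle1) : ℕ → Ω → Circle1 → Circle1
  | 0, _, x => x
  | n + 1, ω, x => ndsIter θ f n (θ ω) (f ω x)

/-- `j` is in a `ν`-trapped period of `ω` for `U`. -/
def IsTrapped {Ω : Type*} (θ : Ω → Ω) (ν : ℕ) (ω : Ω) (U : Set Ω) (j : ℕ) : Prop :=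
  ν ≤ j ∧ ∀ i ≤ ν, θ^[j - i] ω ∈ U

/-- Running the system for `m + n` steps is running it for `m` steps, then for `n` further steps
from the shifted base point. -/
lemma ndsIter_add {Ω : Type*} (θ : Ω → Ω) (f : Ω → Circle1 → Circle1) (m n : ℕ) (ω : Ω)
    (x : Circle1) :
    ndsIter θ f (m + n) ω x = ndsIter θ f n (θ^[m] ω) (ndsIter θ f m ω x) := by
  induction m generalizing ω x with
  | zero => simp [ndsIter]
  | succ m ih =>
    rw [Nat.add_right_comm]
    simp only [ndsIter, Function.iterate_succ_apply, ih]

/-- On the circle, the distance of two projected points is at most their distance in `ℝ`. -/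
lemma dist_coe_circle1_le (a b : ℝ) : dist (a : Circle1) (b : Circle1) ≤ |a - b| := by
  rw [dist_eq_norm, ← AddCircle.coe_sub]
  exact QuotientAddGroup.norm_mk_le_norm

/-- Orbits starting in `I0` lift to `[1/4, 3/4]`, and as long as `κ` stays `η`-close to `c` along
the base orbit they contract towards `1/2 + 2 ε c` up to an error `2 ε η`. -/
lemma exists_lift_ndsIter {Ω : Type*} (θ : Ω → Ω) (f0 : Circle1 → Circle1)
    (hf0 : ∀ xt ∈ Set.Icc (1/4 : ℝ) (3/4), f0 (xt : Circle1) = ((xt / 2 + 1/4 : ℝ) : Circle1))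
    {ε : ℝ} (hε0 : 0 ≤ ε) (hε1 : ε ≤ 1/8)
    (κ : Ω → ℝ) (hκ : ∀ ω, κ ω ∈ Set.Icc (-1 : ℝ) 1)
    (f : Ω → Circle1 → Circle1)
    (hf : ∀ ω x, f ω x = f0 x + ((ε * κ ω : ℝ) : Circle1))
    (c η : ℝ) (n : ℕ) (ω : Ω) (hη : ∀ i < n, |κ (θ^[i] ω) - c| ≤ η)
    {xt : ℝ} (hxt : xt ∈ Set.Icc (1/4 : ℝ) (3/4)) :
    ∃ y ∈ Set.Icc (1/4 : ℝ) (3/4), ndsIter θ f n ω (xt : Circle1) = (y : Circle1) ∧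
      |y - (1/2 + 2 * ε * c)| ≤
        (1/2) ^ n * |xt - (1/2 + 2 * ε * c)| + 2 * ε * η * (1 - (1/2) ^ n) := by
  induction n generalizing ω xt with
  | zero => exact ⟨xt, hxt, rfl, by simp⟩
  | succ n ih =>
    have hstep : f ω (xt : Circle1) = ((xt / 2 + 1/4 + ε * κ ω : ℝ) : Circle1) := by
      rw [hf, hf0 xt hxt, ← AddCircle.coe_add]
    have hmem : xt / 2 + 1/4 + ε * κ ω ∈ Set.Icc (1/4 : ℝ) (3/4) := by
      obtain ⟨h1, h2⟩ := hκ ω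
      obtain ⟨h3, h4⟩ := hxt
      constructor <;> nlinarith
    have hη' : ∀ i < n, |κ (θ^[i] (θ ω)) - c| ≤ η := fun i hi => by
      simpa using hη (i + 1) (by omega)
    obtain ⟨y, hy, hyeq, hyle⟩ := ih (θ ω) hη' hmem
    refine ⟨y, hy, by rw [ndsIter, hstep, hyeq], hyle.trans ?_⟩
    have hκc : |κ ω - c| ≤ η := hη 0 n.succ_pos
    have hcontr : |xt / 2 + 1/4 + ε * κ ω - (1/2 + 2 * ε * c)| ≤
        1/2 * |xt - (1/2 + 2 * ε * c)| + ε * η := by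
      calc |xt / 2 + 1/4 + ε * κ ω - (1/2 + 2 * ε * c)|
          = |1/2 * (xt - (1/2 + 2 * ε * c)) + ε * (κ ω - c)| := by ring_nf
        _ ≤ |1/2 * (xt - (1/2 + 2 * ε * c))| + |ε * (κ ω - c)| := abs_add_le _ _
        _ = 1/2 * |xt - (1/2 + 2 * ε * c)| + ε * |κ ω - c| := by
          rw [abs_mul, abs_mul, abs_of_nonneg hε0, abs_of_pos (one_half_pos (α := ℝ))]
        _ ≤ _ := by gcongr
    calc (1/2) ^ n * |xt / 2 + 1/4 + ε * κ ω - (1/2 + 2 * ε * c)|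
          + 2 * ε * η * (1 - (1/2) ^ n)
        ≤ (1/2) ^ n * (1/2 * |xt - (1/2 + 2 * ε * c)| + ε * η)
          + 2 * ε * η * (1 - (1/2) ^ n) := by gcongr
      _ = _ := by ring

/-- If `2^{-ν₀} ≤ ρ₀/3`, `|κ(ω') - κ(p)| ≤ ρ₀/18` whenever `d_Ω(ω', p) ≤ δ₀`,
and `j` is in a `ν₀`-trapped period of `ω` for `U_{δ₀}(p)`, then
`d_M(f_ω^{(j)}(x), X_p) ≤ (2/3)ρ₀` for every `x ∈ I₀`. -/
theorem trapped_period_close_to_fixedPoint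
    {Ω : Type*} [MetricSpace Ω] (θ : Ω → Ω)
    (f0 : Circle1 → Circle1)
    (hf0 : ∀ xt ∈ Set.Icc (1/4 : ℝ) (3/4), f0 (xt : Circle1) = ((xt / 2 + 1/4 : ℝ) : Circle1))
    (ε : ℝ) (hε0 : 0 < ε) (hε1 : ε < 1/8)
    (κ : Ω → ℝ) (hκrange : ∀ ω, κ ω ∈ Set.Icc (-1 : ℝ) 1)
    (f : Ω → Circle1 → Circle1)
    (hf : ∀ ω x, f ω x = f0 x + ((ε * κ ω : ℝ) : Circle1))
    (p : Ω) (ρ0 : ℝ) (hρ0 : 0 < ρ0)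
    (ν0 : ℕ) (hν0 : 1 ≤ ν0) (hν0' : (1/2 : ℝ) ^ ν0 ≤ ρ0 / 3)
    (δ0 : ℝ) (hδ0 : 0 < δ0)
    (hδ0' : ∀ ω' : Ω, dist ω' p ≤ δ0 → |κ ω' - κ p| ≤ ρ0 / 18)
    (ω : Ω) (j : ℕ) (hj : IsTrapped θ ν0 ω (ball p δ0) j) :
    ∀ x ∈ I0, dist (ndsIter θ f j ω x) (((1/2 + 2 * ε * κ p : ℝ) : Circle1)) ≤ 2/3 * ρ0 := by
  rintro _ ⟨xt, hxt, rfl⟩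
  obtain ⟨hj1, hj2⟩ := hj
  obtain ⟨m, rfl⟩ := Nat.exists_eq_add_of_le' hj1
  obtain ⟨z, hz, hzeq, -⟩ := exists_lift_ndsIter θ f0 hf0 hε0.le hε1.le κ hκrange f hf 0 1 m ω
    (fun i _ => by simpa [abs_le] using hκrange (θ^[i] ω)) hxt
  have hclose : ∀ i < ν0, |κ (θ^[i] (θ^[m] ω)) - κ p| ≤ ρ0 / 18 := fun i hi => by
    have h := hj2 (ν0 - i) (Nat.sub_le _ _)
    rw [show m + ν0 - (ν0 - i) = i + m by omega, Function.iterate_add_apply] at h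
    exact hδ0' _ (mem_ball.1 h).le
  obtain ⟨y, -, hyeq, hyle⟩ := exists_lift_ndsIter θ f0 hf0 hε0.le hε1.le κ hκrange f hf (κ p)
    (ρ0 / 18) ν0 (θ^[m] ω) hclose hz
  have hdist : |z - (1/2 + 2 * ε * κ p)| ≤ 1 := by
    obtain ⟨h1, h2⟩ := hκrange p
    obtain ⟨h3, h4⟩ := hz
    rw [abs_le]
    constructor <;> nlinarith
  simp only [ndsIter_add, hzeq, hyeq]
  have hpow : (0 : ℝ) ≤ (1/2) ^ ν0 := by positivity
  calc dist (y : Circle1) ((1/2 + 2 * ε * κ p : ℝ) : Circle1)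
      ≤ |y - (1/2 + 2 * ε * κ p)| := dist_coe_circle1_le _ _
    _ ≤ (1/2) ^ ν0 * |z - (1/2 + 2 * ε * κ p)| + 2 * ε * (ρ0 / 18) * (1 - (1/2) ^ ν0) := hyle
    _ ≤ (1/2) ^ ν0 * 1 + 2 * (1/8) * (ρ0 / 18) * 1 := by
      gcongr
      · rw [sub_nonneg]
        exact pow_le_one₀ (by norm_num) (by norm_num)
      · linarith
    _ ≤ 2/3 * ρ0 := by linarith

end
end

section
/- Let σ₁, σ₂ be positive real numbers with σ₁σ₂ > 1, and let (a_j)_{j≥1} and (b_j)_{j≥1} be sequences of positive real numbers satisfying a_j/b_j → σ₁ and b_{j+1}/a_j → σ₂ as j → ∞. Then (Σ_{j=1}^{J} b_j) / (Σ_{j=1}^{J} b_j + Σ_{j=1}^{J−1} a_j) → σ₂/(1 + σ₂) as J → ∞. -/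
open Filter Topology

/-- Stolz–Cesàro for a ratio of partial sums with a divergent positive denominator. -/
theorem tendsto_sum_range_div_sum_range {f g : ℕ → ℝ} {l : ℝ} (hg : ∀ n, 0 < g n)
    (hdiv : Tendsto (fun n => ∑ i ∈ Finset.range n, g i) atTop atTop)
    (hfg : Tendsto (fun n => f n / g n) atTop (𝓝 l)) :
    Tendsto (fun n => (∑ i ∈ Finset.range n, f i) / ∑ i ∈ Finset.range n, g i)
      atTop (𝓝 l) := by
  have ho : (fun n => f n - l * g n) =o[atTop] g := by
    refine (Asymptotics.isLittleO_iff_tendsto fun n hn => absurd hn (hg n).ne').2 ?_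
    have h := hfg.sub_const l
    rw [sub_self] at h
    refine h.congr fun n => ?_
    have := (hg n).ne'
    field_simp
  have h := (ho.sum_range (fun n => (hg n).le) hdiv).tendsto_div_nhds_zero.add_const l
  rw [zero_add] at h
  refine h.congr' ?_
  filter_upwards [hdiv.eventually_gt_atTop 0] with n hn
  rw [Finset.sum_sub_distrib, ← Finset.mul_sum]
  field_simp
  ring

/-- Partial sums of a positive sequence whose successive ratios tend to a limit greater than one
diverge. -/
theorem tendsto_sum_range_atTop_of_ratio_tendsto {g : ℕ → ℝ} {l : ℝ} (hl : 1 < l)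
    (hg : ∀ n, 0 < g n) (h : Tendsto (fun n => g (n + 1) / g n) atTop (𝓝 l)) :
    Tendsto (fun n => ∑ i ∈ Finset.range n, g i) atTop atTop := by
  refine (not_summable_iff_tendsto_nat_atTop_of_nonneg fun n => (hg n).le).1 ?_
  refine not_summable_of_ratio_test_tendsto_gt_one hl (h.congr fun n => ?_)
  rw [Real.norm_of_nonneg (hg _).le, Real.norm_of_nonneg (hg _).le]

/-- If `a_j/b_j → σ₁` and `b_{j+1}/a_j → σ₂` with `σ₁, σ₂ > 0` and `σ₁σ₂ > 1`,
then `(∑_{j=1}^J b_j)/(∑_{j=1}^J b_j + ∑_{j=1}^{J-1} a_j) → σ₂/(1 + σ₂)`. -/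
theorem sojourn_ratio_tendsto'
    (σ1 σ2 : ℝ) (hσ1 : 0 < σ1) (hσ2 : 0 < σ2) (hσ12 : 1 < σ1 * σ2)
    (a b : ℕ → ℝ) (ha : ∀ j, 1 ≤ j → 0 < a j) (hb : ∀ j, 1 ≤ j → 0 < b j)
    (hab : Tendsto (fun j => a j / b j) atTop (𝓝 σ1))
    (hba : Tendsto (fun j => b (j + 1) / a j) atTop (𝓝 σ2)) :
    Tendsto (fun J => (∑ j ∈ Finset.Icc 1 J, b j) /
        ((∑ j ∈ Finset.Icc 1 J, b j) + ∑ j ∈ Finset.Icc 1 (J - 1), a j))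
      atTop (𝓝 (σ2 / (1 + σ2))) := by
  have hpos : ∀ n, 0 < a (n + 1) := fun n => ha _ n.succ_pos
  have hratio : Tendsto (fun n => a (n + 1 + 1) / a (n + 1)) atTop (𝓝 (σ1 * σ2)) := by
    refine ((hab.comp (tendsto_add_atTop_nat 2)).mul
      (hba.comp (tendsto_add_atTop_nat 1))).congr fun n => ?_
    exact div_mul_div_cancel₀ (hb (n + 2) (by omega)).ne'
  have hdiv := tendsto_sum_range_atTop_of_ratio_tendsto (g := fun n => a (n + 1)) hσ12 hpos hratio
  have hsum := (tendsto_sum_range_div_sum_range (f := fun n => b (n + 1 + 1)) hpos hdiv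
    (hba.comp (tendsto_add_atTop_nat 1))).add (hdiv.const_div_atTop (b 1))
  rw [add_zero] at hsum
  have hIcc : ∀ (u : ℕ → ℝ) (n : ℕ),
      ∑ j ∈ Finset.Icc 1 n, u j = ∑ i ∈ Finset.range n, u (i + 1) := fun u n => by
    rw [Finset.range_eq_Ico, Finset.sum_Ico_add' u 0 n 1, zero_add]
    rfl
  rw [← tendsto_add_atTop_iff_nat 1, add_comm 1 σ2]
  refine (hsum.div (hsum.add_const 1) (by positivity)).congr' ?_
  filter_upwards [hdiv.eventually_gt_atTop 0] with n hn
  rw [Pi.div_apply, hIcc, hIcc, Nat.add_sub_cancel, Finset.sum_range_succ', zero_add, ← add_div,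
    div_add_one hn.ne', div_div_div_cancel_right₀ hn.ne']
end

section
/- Let Ω be a metric space with a Borel probability measure ℙ, θ : Ω → Ω a map, and p ≠ p̂ two points of Ω. Let z₀, n₀, k₀ ≥ 1 be integers, (a_k)_{k≥k₀} and (b_k)_{k≥k₀} sequences of positive integers with limsup_{k→∞} a_k/k < ∞ and limsup_{k→∞} b_k/k < ∞, (R_k)_{k≥k₀} nonempty subsets of Ω with ℙ(Int R_{k₀}) > 0, and (z_k)_{k≥k₀} with z_k ∈ {z₀, z₀+1}, organised in blocks by a strictly increasing sequence (k(J′))_{J′≥0} with k(0) = k₀: z_k = z₀ for k(J′−1) < k ≤ k(J′) when J′ is odd and z_k = z₀ + 1 when J′ is even (and z_{k₀} = z₀). Set m_k = (z_k + 1)k² + a_k + b_k and m̂_K = Σ_{k=k₀}^{K} m_k. Assume: (i) for every k ≥ k₀ and every ω ∈ R_k, θ^{m_k}ω ∈ Int R_{k+1}; (ii) for every δ > 0 there is K_δ such that for all k ≥ K_δ and all ω ∈ R_k: θ^{a_k + n₀ + j}ω ∈ U_δ(p) for all integers 0 ≤ j ≤ z_k k² − 2n₀, and θ^{a_k + n₀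 + z_k k² + j}ω ∈ U_δ(p̂) for all integers 0 ≤ j ≤ k² − 2n₀; (iii) m̂_{k(J′−1)}/m̂_{k(J′)} → 0 as J′ → ∞. Then θ satisfies condition (H) with Γ = Int R_{k₀}, λ₁ = 1/(z₀+1) and λ₂ = 1/(z₀+2): for every ω ∈ Int R_{k₀}, every integer ν ≥ 0 and every δ with 0 < δ < d_Ω(p,p̂)/2, setting n₁(J) = m̂_{k(2J−1)} and n₂(J) = m̂_{k(2J)}, one has for i = 1, 2: N_ν(ω, U_δ(p); n_i(J))/n_i(J) → 1 − λ_i and N_ν(ω, U_δ(p̂); n_i(J))/n_i(J) → λ_i as J → ∞; moreover λ₁ ≠ λ₂. -/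
open MeasureTheory Filter Metric Set Topology

noncomputable section

/-- `N_ν(ω, U; n)`: the number of `j ∈ [0, n-1]` in a `ν`-trapped period of `ω` for `U`. -/
def Ncount {Ω : Type*} (θ : Ω → Ω) (ν : ℕ) (ω : Ω) (U : Set Ω) (n : ℕ) : ℕ :=
  {j : ℕ | j < n ∧ IsTrapped θ ν ω U j}.ncard

section Counting

variable {Ω : Type*} {θ : Ω → Ω} {ν : ℕ} {ω : Ω} {U V : Set Ω}

lemma Ncount_set_finite (θ : Ω → Ω) (ν : ℕ) (ω : Ω) (U : Set Ω) (n : ℕ) :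
    {j : ℕ | j < n ∧ IsTrapped θ ν ω U j}.Finite :=
  (Set.finite_lt_nat n).subset fun _ hj => hj.1

lemma Ncount_mono {n N : ℕ} (h : n ≤ N) : Ncount θ ν ω U n ≤ Ncount θ ν ω U N :=
  Set.ncard_le_ncard (fun _ hj => ⟨hj.1.trans_le h, hj.2⟩) (Ncount_set_finite ..)

/-- An orbit segment of length `L + 1` in `U` contributes at least `L + 1 - ν` trapped times. -/
lemma Ncount_add_le {n s L N : ℕ} (hns : n ≤ s) (hsN : s + L < N)
    (h : ∀ j ≤ L, θ^[s + j] ω ∈ U) :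
    Ncount θ ν ω U n + (L + 1 - ν) ≤ Ncount θ ν ω U N := by
  rcases le_or_gt ν L with hL | hL
  · have hdisj : Disjoint {j : ℕ | j < n ∧ IsTrapped θ ν ω U j}
        (Finset.Ico (s + ν) (s + L + 1) : Set ℕ) := by
      rw [Set.disjoint_left]
      intro j hj hj'
      have := hj.1
      simp only [Finset.coe_Ico, Set.mem_Ico] at hj'
      omega
    have hcard : (Finset.Ico (s + ν) (s + L + 1) : Set ℕ).ncard = L + 1 - ν := by
      rw [Set.ncard_coe_finset, Nat.card_Ico]
      omega
    unfold Ncount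
    rw [← hcard, ← Set.ncard_union_eq hdisj (Ncount_set_finite ..) (Finset.finite_toSet _)]
    refine Set.ncard_le_ncard ?_ (Ncount_set_finite ..)
    rintro j (hj | hj)
    · exact ⟨by have := hj.1; omega, hj.2⟩
    · simp only [Finset.coe_Ico, Set.mem_Ico] at hj
      refine ⟨by omega, by omega, fun i hi => ?_⟩
      have hji := h (j - i - s) (by omega)
      rwa [show s + (j - i - s) = j - i by omega] at hji
  · rw [Nat.sub_eq_zero_of_le hL, add_zero]
    exact Ncount_mono (by omega)

lemma Ncount_add_Ncount_le (h : Disjoint U V) (n : ℕ) :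
    Ncount θ ν ω U n + Ncount θ ν ω V n ≤ n := by
  have hdisj : Disjoint {j : ℕ | j < n ∧ IsTrapped θ ν ω U j}
      {j : ℕ | j < n ∧ IsTrapped θ ν ω V j} := by
    rw [Set.disjoint_left]
    intro j hj hj'
    exact Set.disjoint_left.1 h (hj.2.2 0 (Nat.zero_le _)) (hj'.2.2 0 (Nat.zero_le _))
  unfold Ncount
  rw [← Set.ncard_union_eq hdisj (Ncount_set_finite ..) (Ncount_set_finite ..)]
  calc _ ≤ (Finset.range n : Set ℕ).ncard := by
        refine Set.ncard_le_ncard ?_ (Finset.finite_toSet _)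
        rintro j (hj | hj) <;> simpa using hj.1
    _ = n := by rw [Set.ncard_coe_finset, Finset.card_range]

/-- Lower bounds on the gain of `Ncount` over consecutive blocks add up. -/
lemma sum_le_Ncount_add_sum {k0 : ℕ} {M w d : ℕ → ℕ}
    (h : ∀ k, k0 ≤ k → Ncount θ ν ω U (M k) + w k ≤ Ncount θ ν ω U (M (k + 1)) + d k)
    {K : ℕ} (hK : k0 ≤ K) :
    ∑ k ∈ Finset.Ico k0 K, w k ≤ Ncount θ ν ω U (M K) + ∑ k ∈ Finset.Ico k0 K, d k := by
  induction K, hK using Nat.le_induction with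
  | base => simp
  | succ K hK ih =>
    rw [Finset.sum_Ico_succ_top hK, Finset.sum_Ico_succ_top hK]
    have := h K hK
    omega

/-- The orbit enters `R k` at the start of block `k`. -/
lemma iterate_sum_mem [TopologicalSpace Ω] {R : ℕ → Set Ω} {m : ℕ → ℕ} {k0 : ℕ}
    (hi : ∀ k, k0 ≤ k → ∀ ω ∈ R k, θ^[m k] ω ∈ interior (R (k + 1)))
    (hω : ω ∈ interior (R k0)) {K : ℕ} (hK : k0 ≤ K) :
    θ^[∑ k ∈ Finset.Ico k0 K, m k] ω ∈ R K := by
  induction K, hK using Nat.le_induction with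
  | base => simpa using interior_subset hω
  | succ K hK ih =>
    rw [Finset.sum_Ico_succ_top hK, add_comm _ (m K), Function.iterate_add_apply]
    exact interior_subset (hi K hK _ ih)

end Counting

section Asymptotics

lemma isBigO_natCast_of_div_le {a : ℕ → ℕ}
    (h : ∃ C : ℝ, ∀ᶠ k in atTop, (a k : ℝ) / (k : ℝ) ≤ C) :
    (fun k => (a k : ℝ)) =O[atTop] fun k : ℕ => (k : ℝ) := by
  obtain ⟨C, hC⟩ := h
  refine Asymptotics.IsBigO.of_bound C ?_
  filter_upwards [hC, eventually_gt_atTop 0] with k hk hk0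
  have : (0 : ℝ) < k := by exact_mod_cast hk0
  rw [div_le_iff₀ this] at hk
  simpa using hk

lemma tendsto_sum_Ico_div_sum_Ico {d m : ℕ → ℕ} {k0 : ℕ} (hm : ∀ k, k0 ≤ k → 0 < m k)
    (h : (fun k => (d k : ℝ)) =o[atTop] fun k => (m k : ℝ)) :
    Tendsto (fun K => ((∑ k ∈ Finset.Ico k0 K, d k : ℕ) : ℝ) /
      ((∑ k ∈ Finset.Ico k0 K, m k : ℕ) : ℝ)) atTop (𝓝 0) := by
  have hshift : Tendsto (fun j => k0 + j) atTop atTop :=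
    tendsto_atTop_mono (fun j => Nat.le_add_left j k0) tendsto_id
  have hdiv : Tendsto (fun n => ∑ j ∈ Finset.range n, (m (k0 + j) : ℝ)) atTop atTop := by
    refine tendsto_atTop_mono (fun n => ?_) tendsto_natCast_atTop_atTop
    calc (n : ℝ) = ∑ j ∈ Finset.range n, (1 : ℝ) := by simp
      _ ≤ _ := Finset.sum_le_sum fun j _ => by exact_mod_cast hm _ (Nat.le_add_right _ _)
  have hsum := ((h.comp_tendsto hshift).sum_range (fun j => Nat.cast_nonneg _)
    hdiv).tendsto_div_nhds_zero.comp (tendsto_sub_atTop_nat k0)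
  refine hsum.congr fun K => ?_
  simp [Finset.sum_Ico_eq_sum_range]

/-- The frequency limits, given that up to errors `D` and `P` the total `M` splits into
`ζ + 1` equal parts, one of which is `B` and the others make up `A`. -/
lemma tendsto_frequencies {x y M A B D P : ℕ → ℝ} {ζ : ℝ} (hζ : 0 ≤ ζ)
    (hM : ∀ᶠ J in atTop, 0 < M J)
    (hx : ∀ᶠ J in atTop, A J ≤ x J + D J) (hy : ∀ᶠ J in atTop, B J ≤ y J + D J)
    (hxy : ∀ᶠ J in atTop, x J + y J ≤ M J)
    (hlow : ∀ᶠ J in atTop, A J + B J ≤ M J) (hup : ∀ᶠ J in atTop, M J ≤ A J + B J + D J)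
    (hAB : ∀ᶠ J in atTop, |A J - ζ * B J| ≤ P J)
    (hD : Tendsto (fun J => D J / M J) atTop (𝓝 0))
    (hP : Tendsto (fun J => P J / M J) atTop (𝓝 0)) :
    Tendsto (fun J => x J / M J) atTop (𝓝 (1 - 1 / (ζ + 1))) ∧
      Tendsto (fun J => y J / M J) atTop (𝓝 (1 / (ζ + 1))) := by
  have hzero : Tendsto (fun J => 2 * (ζ + 1) * (D J / M J) + D J / M J + P J / M J)
      atTop (𝓝 0) := by
    simpa using ((hD.const_mul (2 * (ζ + 1))).add hD).add hP
  have hy' : Tendsto (fun J => y J / M J) atTop (𝓝 (1 / (ζ + 1))) := by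
    rw [tendsto_iff_dist_tendsto_zero]
    refine squeeze_zero' (Eventually.of_forall fun _ => dist_nonneg) ?_ hzero
    filter_upwards [hM, hx, hy, hxy, hlow, hup, hAB] with J hM hx hy hxy hlow hup hAB
    have hz : 1 ≤ ζ + 1 := by linarith
    have hD0 : 0 ≤ D J := by linarith
    rw [abs_le] at hAB
    have h1 : |y J - B J| ≤ 2 * D J := abs_le.2 ⟨by linarith, by linarith⟩
    have key : |(ζ + 1) * y J - M J| ≤ 2 * (ζ + 1) * D J + D J + P J := by
      have e : (ζ + 1) * y J - M J
          = (ζ + 1) * (y J - B J) + ((ζ * B J - A J) + (A J + B J - M J)) := by ring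
      have h2 : |(ζ + 1) * (y J - B J)| ≤ (ζ + 1) * (2 * D J) := by
        rw [abs_mul, abs_of_pos (by linarith : 0 < ζ + 1)]
        gcongr
      have h3 : |(ζ * B J - A J) + (A J + B J - M J)| ≤ P J + D J :=
        abs_le.2 ⟨by linarith, by linarith⟩
      rw [e]
      linarith [abs_add_le ((ζ + 1) * (y J - B J)) ((ζ * B J - A J) + (A J + B J - M J))]
    have e : y J / M J - 1 / (ζ + 1) = ((ζ + 1) * y J - M J) / ((ζ + 1) * M J) := by
      field_simp
    rw [Real.dist_eq, e, abs_div, abs_of_pos (by positivity : 0 < (ζ + 1) * M J)]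
    calc _ ≤ |(ζ + 1) * y J - M J| / M J := by
          gcongr
          nlinarith
      _ ≤ (2 * (ζ + 1) * D J + D J + P J) / M J := by gcongr
      _ = _ := by ring
  refine ⟨?_, hy'⟩
  have hs : Tendsto (fun J => x J / M J + y J / M J) atTop (𝓝 1) := by
    have hl : Tendsto (fun J => 1 - 3 * (D J / M J)) atTop (𝓝 1) := by
      simpa using (hD.const_mul 3).const_sub 1
    refine tendsto_of_tendsto_of_tendsto_of_le_of_le' hl tendsto_const_nhds ?_ ?_
    · filter_upwards [hM, hx, hy, hup] with J hM hx hy hup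
      rw [← add_div, le_div_iff₀ hM]
      have : (1 - 3 * (D J / M J)) * M J = M J - 3 * D J := by field_simp
      linarith
    · filter_upwards [hM, hxy] with J hM hxy
      rw [← add_div, div_le_one hM]
      exact hxy
  simpa using hs.sub hy'

end Asymptotics

/-- If `z` equals `ζ` on `(K', K]` and is within `1` of `ζ` before, the sum of `(z - ζ) k²` is
controlled by the sum up to `K'`. -/
lemma abs_sum_sub_mul_sum_le {z m : ℕ → ℕ} {ζ k0 K' K : ℕ} (hK' : k0 ≤ K') (hK : K' ≤ K)
    (hm : ∀ k, k ^ 2 ≤ m k) (hz1 : ∀ k, |(z k : ℝ) - ζ| ≤ 1)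
    (hz : ∀ k, K' ≤ k → k < K → z k = ζ) :
    |((∑ k ∈ Finset.Ico k0 K, z k * k ^ 2 : ℕ) : ℝ) -
      ζ * ((∑ k ∈ Finset.Ico k0 K, k ^ 2 : ℕ) : ℝ)| ≤
      ((∑ k ∈ Finset.Ico k0 K', m k : ℕ) : ℝ) := by
  have htail : ∑ k ∈ Finset.Ico K' K, ((z k : ℝ) - ζ) * (k : ℝ) ^ 2 = 0 :=
    Finset.sum_eq_zero fun k hk => by
      rw [Finset.mem_Ico] at hk
      rw [hz k hk.1 hk.2, sub_self, zero_mul]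
  have e : ((∑ k ∈ Finset.Ico k0 K, z k * k ^ 2 : ℕ) : ℝ) -
      ζ * ((∑ k ∈ Finset.Ico k0 K, k ^ 2 : ℕ) : ℝ)
      = ∑ k ∈ Finset.Ico k0 K', ((z k : ℝ) - ζ) * (k : ℝ) ^ 2 := by
    push_cast
    rw [Finset.mul_sum, ← Finset.sum_sub_distrib, ← add_zero (∑ k ∈ Finset.Ico k0 K', _),
      ← htail, Finset.sum_Ico_consecutive _ hK' hK]
    exact Finset.sum_congr rfl fun k _ => by ring
  rw [e]
  push_cast
  refine (Finset.abs_sum_le_sum_abs _ _).trans (Finset.sum_le_sum fun k _ => ?_)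
  rw [abs_mul, abs_of_nonneg (by positivity : (0 : ℝ) ≤ (k : ℝ) ^ 2)]
  have h1 : (k : ℝ) ^ 2 ≤ m k := by exact_mod_cast hm k
  nlinarith [hz1 k, sq_nonneg (k : ℝ)]

/-- The dynamical part of the theorem on Newhouse open sets: a driving system
`θ` admitting rectangles `R_k`, travel times `m_k` and itineraries as in (i)–(iii) satisfies
condition (H) with `Γ = Int R_{k₀}`, `λ₁ = 1/(z₀+1)`, `λ₂ = 1/(z₀+2)`,
`n₁(J) = m̂_{k(2J-1)}`, `n₂(J) = m̂_{k(2J)}`. -/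
theorem newhouse_driving_condition_H
    {Ω : Type*} [MetricSpace Ω] [MeasurableSpace Ω] [BorelSpace Ω]
    (ℙ : Measure Ω) [IsProbabilityMeasure ℙ]
    (θ : Ω → Ω) (p phat : Ω) (hp : p ≠ phat)
    (z0 n0 k0 : ℕ) (hz0 : 1 ≤ z0) (hn0 : 1 ≤ n0) (hk0 : 1 ≤ k0)
    (a b : ℕ → ℕ) (ha : ∀ k, k0 ≤ k → 0 < a k) (hb : ∀ k, k0 ≤ k → 0 < b k)
    (hla : ∃ C : ℝ, ∀ᶠ k in atTop, (a k : ℝ) / (k : ℝ) ≤ C)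
    (hlb : ∃ C : ℝ, ∀ᶠ k in atTop, (b k : ℝ) / (k : ℝ) ≤ C)
    (R : ℕ → Set Ω) (hRne : ∀ k, k0 ≤ k → (R k).Nonempty)
    (hR0 : 0 < ℙ (interior (R k0)))
    (z : ℕ → ℕ) (hzval : ∀ k, z k = z0 ∨ z k = z0 + 1)
    (kk : ℕ → ℕ) (hkk0 : kk 0 = k0) (hkkmono : StrictMono kk)
    (hzk0 : z k0 = z0)
    (hzblock : ∀ J' : ℕ, 1 ≤ J' → ∀ k : ℕ, kk (J' - 1) < k → k ≤ kk J' →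
      z k = if J' % 2 = 1 then z0 else z0 + 1)
    (m : ℕ → ℕ) (hm : ∀ k, m k = (z k + 1) * k ^ 2 + a k + b k)
    (mhat : ℕ → ℕ) (hmhat : ∀ K, mhat K = ∑ k ∈ Finset.Icc k0 K, m k)
    (hi : ∀ k, k0 ≤ k → ∀ ω ∈ R k, θ^[m k] ω ∈ interior (R (k + 1)))
    (hii : ∀ δ : ℝ, 0 < δ → ∃ Kδ : ℕ, ∀ k, Kδ ≤ k → k0 ≤ k → ∀ ω ∈ R k,
      (∀ j : ℕ, j ≤ z k * k ^ 2 - 2 * n0 → θ^[a k + n0 + j] ω ∈ ball p δ) ∧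
      (∀ j : ℕ, j ≤ k ^ 2 - 2 * n0 → θ^[a k + n0 + z k * k ^ 2 + j] ω ∈ ball phat δ))
    (hiii : Tendsto (fun J' : ℕ => (mhat (kk (J' - 1)) : ℝ) / (mhat (kk J') : ℝ))
      atTop (𝓝 0)) :
    ((1 : ℝ) / (z0 + 1) ≠ 1 / (z0 + 2)) ∧
    ∀ ω ∈ interior (R k0), ∀ ν : ℕ, ∀ δ : ℝ, 0 < δ → δ < dist p phat / 2 →
      Tendsto (fun J : ℕ => (Ncount θ ν ω (ball p δ) (mhat (kk (2 * J - 1))) : ℝ) /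
          (mhat (kk (2 * J - 1)) : ℝ)) atTop (𝓝 (1 - 1 / ((z0 : ℝ) + 1))) ∧
      Tendsto (fun J : ℕ => (Ncount θ ν ω (ball phat δ) (mhat (kk (2 * J - 1))) : ℝ) /
          (mhat (kk (2 * J - 1)) : ℝ)) atTop (𝓝 (1 / ((z0 : ℝ) + 1))) ∧
      Tendsto (fun J : ℕ => (Ncount θ ν ω (ball p δ) (mhat (kk (2 * J))) : ℝ) /
          (mhat (kk (2 * J)) : ℝ)) atTop (𝓝 (1 - 1 / ((z0 : ℝ) + 2))) ∧
      Tendsto (fun J : ℕ => (Ncount θ ν ω (ball phat δ) (mhat (kk (2 * J))) : ℝ) /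
          (mhat (kk (2 * J)) : ℝ)) atTop (𝓝 (1 / ((z0 : ℝ) + 2))) := by
  have hne : ((1 : ℝ) / (z0 + 1) ≠ 1 / (z0 + 2)) := by
    intro h
    rw [div_eq_div_iff (by positivity) (by positivity)] at h
    linarith
  refine ⟨hne, fun ω hω ν δ hδ hδ' => ?_⟩
  obtain ⟨Kδ, hKδ⟩ := hii δ hδ
  set M : ℕ → ℕ := fun K => ∑ k ∈ Finset.Ico k0 K, m k with hMdef
  have hmM : ∀ K, mhat K = M (K + 1) := fun K => by
    simp only [hmhat, hMdef, Finset.Ico_add_one_right_eq_Icc]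
  have hMsucc : ∀ k, k0 ≤ k → M (k + 1) = M k + m k := fun k hk =>
    Finset.sum_Ico_succ_top hk _
  have hsq_le : ∀ k, k ^ 2 ≤ m k := fun k => by
    rw [hm]
    nlinarith [Nat.zero_le (z k * k ^ 2)]
  have hm_pos : ∀ k, k0 ≤ k → 0 < m k := fun k hk => by
    have := ha k hk
    rw [hm]
    omega
  have hz_pos : ∀ k, 1 ≤ z k := fun k => by
    rcases hzval k with h | h <;> omega
  -- The error made in block `k`; blocks before `K1` are discarded altogether.
  set K1 : ℕ := max Kδ (2 * n0) with hK1
  set d : ℕ → ℕ := fun k =>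
    a k + b k + (2 * n0 + ν) + if k < K1 then (z k + 1) * k ^ 2 else 0 with hd
  have hpos : ∀ k, k0 ≤ k → θ^[M k] ω ∈ R k := fun k hk => iterate_sum_mem hi hω hk
  have hblock : ∀ k, k0 ≤ k →
      (Ncount θ ν ω (ball p δ) (M k) + z k * k ^ 2 ≤
        Ncount θ ν ω (ball p δ) (M (k + 1)) + d k) ∧
      (Ncount θ ν ω (ball phat δ) (M k) + k ^ 2 ≤
        Ncount θ ν ω (ball phat δ) (M (k + 1)) + d k) := by
    intro k hk
    have hle : M k ≤ M (k + 1) := by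
      rw [hMsucc k hk]
      omega
    rcases lt_or_ge k K1 with hkK | hkK
    · have h1 := Ncount_mono (θ := θ) (ν := ν) (ω := ω) (U := ball p δ) hle
      have h2 := Ncount_mono (θ := θ) (ν := ν) (ω := ω) (U := ball phat δ) hle
      simp only [hd, if_pos hkK, add_mul, one_mul]
      omega
    · obtain ⟨h1, h2⟩ := hKδ k ((le_max_left _ _).trans hkK) hk _ (hpos k hk)
      have hk2 : 2 * n0 ≤ k ^ 2 :=
        ((le_max_right _ _).trans hkK).trans (Nat.le_self_pow two_ne_zero k)
      have hzk : k ^ 2 ≤ z k * k ^ 2 := Nat.le_mul_of_pos_left _ (hz_pos k)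
      have hmk : m k = z k * k ^ 2 + k ^ 2 + a k + b k := by
        rw [hm]
        ring
      have hbk := hb k hk
      have h3 := Ncount_add_le (θ := θ) (ν := ν) (ω := ω) (U := ball p δ)
        (n := M k) (s := M k + (a k + n0)) (L := z k * k ^ 2 - 2 * n0) (N := M (k + 1))
        (by omega) (by rw [hMsucc k hk]; omega) fun j hj => by
          rw [show M k + (a k + n0) + j = (a k + n0 + j) + M k by ring,
            Function.iterate_add_apply]
          exact h1 j hj
      have h4 := Ncount_add_le (θ := θ) (ν := ν) (ω := ω) (U := ball phat δ)
        (n := M k) (s := M k + (a k + n0 + z k * k ^ 2)) (L := k ^ 2 - 2 * n0) (N := M (k + 1))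
        (by omega) (by rw [hMsucc k hk]; omega) fun j hj => by
          rw [show M k + (a k + n0 + z k * k ^ 2) + j
            = (a k + n0 + z k * k ^ 2 + j) + M k by ring, Function.iterate_add_apply]
          exact h2 j hj
      simp only [hd, if_neg hkK.not_gt]
      omega
  have hxsum : ∀ K, k0 ≤ K → ∑ k ∈ Finset.Ico k0 K, z k * k ^ 2 ≤
      Ncount θ ν ω (ball p δ) (M K) + ∑ k ∈ Finset.Ico k0 K, d k := fun K hK =>
    sum_le_Ncount_add_sum (fun k hk => (hblock k hk).1) hK
  have hysum : ∀ K, k0 ≤ K → ∑ k ∈ Finset.Ico k0 K, k ^ 2 ≤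
      Ncount θ ν ω (ball phat δ) (M K) + ∑ k ∈ Finset.Ico k0 K, d k := fun K hK =>
    sum_le_Ncount_add_sum (fun k hk => (hblock k hk).2) hK
  have hdisj : Disjoint (ball p δ) (ball phat δ) := ball_disjoint_ball (by linarith)
  have hlow : ∀ K, ∑ k ∈ Finset.Ico k0 K, z k * k ^ 2 + ∑ k ∈ Finset.Ico k0 K, k ^ 2 ≤ M K :=
    fun K => by
      rw [← Finset.sum_add_distrib]
      refine Finset.sum_le_sum fun k _ => ?_
      rw [hm, add_mul, one_mul]
      omega
  have hup : ∀ K, M K ≤ ∑ k ∈ Finset.Ico k0 K, z k * k ^ 2 + ∑ k ∈ Finset.Ico k0 K, k ^ 2 +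
      ∑ k ∈ Finset.Ico k0 K, d k := fun K => by
    rw [← Finset.sum_add_distrib, ← Finset.sum_add_distrib]
    refine Finset.sum_le_sum fun k _ => ?_
    simp only [hd]
    rw [hm, add_mul, one_mul]
    omega
  have hdo : (fun k => (d k : ℝ)) =o[atTop] fun k => (m k : ℝ) := by
    have hlin : (fun k => (d k : ℝ)) =O[atTop] fun k : ℕ => (k : ℝ) := by
      have hconst : (fun _ : ℕ => ((2 * n0 + ν : ℕ) : ℝ)) =O[atTop] fun k : ℕ => (k : ℝ) :=
        (Asymptotics.isLittleO_const_left.2 (Or.inr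
          (tendsto_norm_atTop_atTop.comp tendsto_natCast_atTop_atTop))).isBigO
      refine (((isBigO_natCast_of_div_le hla).add (isBigO_natCast_of_div_le hlb)).add
        hconst).congr' ?_ EventuallyEq.rfl
      filter_upwards [eventually_ge_atTop K1] with k hk
      simp [hd, hk.not_gt]
    have hsq : (fun k : ℕ => (k : ℝ)) =o[atTop] fun k : ℕ => (k : ℝ) ^ 2 := by
      simpa [Function.comp_def] using (Asymptotics.isLittleO_pow_pow_atTop_of_lt (𝕜 := ℝ) one_lt_two).comp_tendsto
        tendsto_natCast_atTop_atTop
    refine (hlin.trans_isLittleO hsq).trans_isBigO (Asymptotics.IsBigO.of_norm_le fun k => ?_)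
    rw [Real.norm_of_nonneg (by positivity)]
    exact_mod_cast hsq_le k
  have hDlim := tendsto_sum_Ico_div_sum_Ico hm_pos hdo
  have hkk_ge : ∀ J, k0 ≤ kk J := fun J => hkk0 ▸ hkkmono.monotone (Nat.zero_le J)
  -- The limits along any sequence of blocks with a common value `ζ` of `z`.
  have main : ∀ (ζ : ℕ) (u : ℕ → ℕ), Tendsto u atTop atTop → (∀ k, |(z k : ℝ) - ζ| ≤ 1) →
      (∀ᶠ J in atTop, ∀ k, kk (u J - 1) < k → k ≤ kk (u J) → z k = ζ) →
      Tendsto (fun J => (Ncount θ ν ω (ball p δ) (mhat (kk (u J))) : ℝ) /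
        (mhat (kk (u J)) : ℝ)) atTop (𝓝 (1 - 1 / ((ζ : ℝ) + 1))) ∧
      Tendsto (fun J => (Ncount θ ν ω (ball phat δ) (mhat (kk (u J))) : ℝ) /
        (mhat (kk (u J)) : ℝ)) atTop (𝓝 (1 / ((ζ : ℝ) + 1))) := by
    intro ζ u hu hζ1 hζ
    have hge : ∀ J, k0 ≤ kk (u J) + 1 := fun J => (hkk_ge _).trans (Nat.le_succ _)
    have hkku : Tendsto (fun J => kk (u J) + 1) atTop atTop :=
      (tendsto_add_atTop_nat 1).comp (hkkmono.tendsto_atTop.comp hu)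
    simp only [hmM]
    refine tendsto_frequencies
      (A := fun J => ((∑ k ∈ Finset.Ico k0 (kk (u J) + 1), z k * k ^ 2 : ℕ) : ℝ))
      (B := fun J => ((∑ k ∈ Finset.Ico k0 (kk (u J) + 1), k ^ 2 : ℕ) : ℝ))
      (D := fun J => ((∑ k ∈ Finset.Ico k0 (kk (u J) + 1), d k : ℕ) : ℝ))
      (P := fun J => (M (kk (u J - 1) + 1) : ℝ)) (Nat.cast_nonneg ζ)
      (Eventually.of_forall fun J => ?_)
      (Eventually.of_forall fun J => mod_cast hxsum _ (hge J))
      (Eventually.of_forall fun J => mod_cast hysum _ (hge J))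
      (Eventually.of_forall fun J => mod_cast Ncount_add_Ncount_le hdisj _)
      (Eventually.of_forall fun J => mod_cast hlow _)
      (Eventually.of_forall fun J => mod_cast hup _) ?_ (hDlim.comp hkku) ?_
    · have h1 := hMsucc _ (hkk_ge (u J))
      have h2 := hm_pos _ (hkk_ge (u J))
      exact_mod_cast (by omega : 0 < M (kk (u J) + 1))
    · filter_upwards [hζ] with J hJ
      refine abs_sum_sub_mul_sum_le ((hkk_ge _).trans (Nat.le_succ _))
        (Nat.succ_le_succ (hkkmono.monotone (Nat.sub_le _ _))) hsq_le hζ1 fun k hk hk' => ?_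
      exact hJ k hk (Nat.lt_succ_iff.1 hk')
    · have h := hiii.comp hu
      simp only [hmM] at h
      exact h
  have hodd := main z0 (fun J => 2 * J - 1)
    (tendsto_atTop_mono' _ ((eventually_ge_atTop 1).mono fun J hJ => by simp only [id]; omega)
      tendsto_id)
    (fun k => by rcases hzval k with h | h <;> simp [h])
    ((eventually_ge_atTop 1).mono fun J hJ k hk hk' => by
      rw [hzblock (2 * J - 1) (by omega) k hk hk', if_pos (by omega)])
  have heven := main (z0 + 1) (fun J => 2 * J)
    (tendsto_atTop_mono (fun J => by simp only [id]; omega) tendsto_id)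
    (fun k => by rcases hzval k with h | h <;> simp [h])
    ((eventually_ge_atTop 1).mono fun J hJ k hk hk' => by
      rw [hzblock (2 * J) (by omega) k hk hk', if_neg (by omega)])
  have hcast : ((z0 + 1 : ℕ) : ℝ) + 1 = (z0 : ℝ) + 2 := by
    push_cast
    ring
  rw [hcast] at heven
  exact ⟨hodd.1, hodd.2, heven.1, heven.2⟩
end
end
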